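/- Let θ > 0, σ > 0 and t ≥ 0 be real numbers. Then the double integral σ² ∫₀ᵗ ∫₀ᵗ e^{-θs} e^{-θr} · (1/(2θ)) (e^{2θ·min(s,r)} - 1) dr ds equals (σ²/θ³) (θt + 2 e^{-θt} - (1/2) e^{-2θt} - 3/2). -/

import Mathlib

/-- The inner integral: the covariance of an Ornstein–Uhlenbeck process integrated in one
variable. -/
lemma integral_ou_covariance {θ s : ℝ} (t : ℝ) (hθ : 0 < θ) (hs : 0 ≤ s) (hst : s ≤ t) :
    ∫ r in (0:ℝ)..t, Real.exp (-θ * s) * Real.exp (-θ * r) *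
        (1 / (2 * θ) * (Real.exp (2 * θ * min s r) - 1)) =
      1 / (2 * θ ^ 2) * (2 - 2 * Real.exp (-θ * s) - Real.exp (-θ * t) * Real.exp (θ * s) +
        Real.exp (-θ * t) * Real.exp (-θ * s)) := by
  have hexp (c x : ℝ) :
      HasDerivAt (fun r => Real.exp (c * r)) (Real.exp (c * x) * c) x := by
    simpa using ((hasDerivAt_id x).const_mul c).exp
  have hprod : Real.exp (-θ * s) * Real.exp (θ * s) = 1 := by
    rw [← Real.exp_add]; simp
  have hdouble (x : ℝ) : Real.exp (2 * θ * x) = Real.exp (θ * x) * Real.exp (θ * x) := by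
    rw [← Real.exp_add]; ring_nf
  have hcont : Continuous fun r : ℝ => Real.exp (-θ * s) * Real.exp (-θ * r) *
      (1 / (2 * θ) * (Real.exp (2 * θ * min s r) - 1)) := by fun_prop
  rw [← intervalIntegral.integral_add_adjacent_intervals
    (hcont.intervalIntegrable 0 s) (hcont.intervalIntegrable s t)]
  have hleft : ∫ r in (0:ℝ)..s, Real.exp (-θ * s) * Real.exp (-θ * r) *
      (1 / (2 * θ) * (Real.exp (2 * θ * min s r) - 1)) =
      Real.exp (-θ * s) / (2 * θ ^ 2) * (Real.exp (θ * s) + Real.exp (-θ * s)) -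
      Real.exp (-θ * s) / (2 * θ ^ 2) * (Real.exp (θ * 0) + Real.exp (-θ * 0)) := by
    refine intervalIntegral.integral_eq_sub_of_hasDerivAt
      (f := fun r => Real.exp (-θ * s) / (2 * θ ^ 2) * (Real.exp (θ * r) + Real.exp (-θ * r)))
      (fun r hr => ?_) (hcont.intervalIntegrable _ _)
    rw [Set.uIcc_of_le hs] at hr
    refine (((hexp θ r).add (hexp (-θ) r)).const_mul _).congr_deriv ?_
    have hr' : Real.exp (-θ * r) * Real.exp (θ * r) = 1 := by
      rw [← Real.exp_add]; simp
    rw [min_eq_right hr.2, hdouble]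
    field_simp
    rw [neg_mul] at hr'
    linear_combination (-Real.exp (θ * r)) * hr'
  have hright : ∫ r in s..t, Real.exp (-θ * s) * Real.exp (-θ * r) *
      (1 / (2 * θ) * (Real.exp (2 * θ * min s r) - 1)) =
      (-Real.exp (-θ * s) / (2 * θ ^ 2) * (Real.exp (2 * θ * s) - 1)) * Real.exp (-θ * t) -
      (-Real.exp (-θ * s) / (2 * θ ^ 2) * (Real.exp (2 * θ * s) - 1)) * Real.exp (-θ * s) := by
    refine intervalIntegral.integral_eq_sub_of_hasDerivAt
      (f := fun r => (-Real.exp (-θ * s) / (2 * θ ^ 2) * (Real.exp (2 * θ * s) - 1)) *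
        Real.exp (-θ * r))
      (fun r hr => ?_) (hcont.intervalIntegrable _ _)
    rw [Set.uIcc_of_le hst] at hr
    refine ((hexp (-θ) r).const_mul _).congr_deriv ?_
    rw [min_eq_left hr.1]
    field_simp
  rw [hleft, hright, hdouble]
  simp only [mul_zero, Real.exp_zero]
  generalize Real.exp (-θ * s) = a at *
  generalize Real.exp (θ * s) = b at *
  generalize Real.exp (-θ * t) = c at *
  field_simp
  linear_combination (2 - b * c + a * b) * hprod

/-- The variance of the time integral of an Ornstein–Uhlenbeck process as a
double integral of the covariance function:
`σ² ∫₀ᵗ ∫₀ᵗ e^{-θ s} e^{-θ r} (1/(2θ))(e^{2θ min(s,r)} - 1) dr ds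
  = (σ²/θ³)(θ t + 2 e^{-θ t} - ½ e^{-2θ t} - 3/2)`. -/
theorem ou_time_integral_variance_double (θ σ t : ℝ) (hθ : 0 < θ) (hσ : 0 < σ)
    (ht : 0 ≤ t) :
    σ ^ 2 *
        ∫ s in (0:ℝ)..t, ∫ r in (0:ℝ)..t,
          Real.exp (-θ * s) * Real.exp (-θ * r) *
            (1 / (2 * θ) * (Real.exp (2 * θ * min s r) - 1)) =
      σ ^ 2 / θ ^ 3 *
        (θ * t + 2 * Real.exp (-θ * t) - 1 / 2 * Real.exp (-2 * θ * t) - 3 / 2) := by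
  have hinner : Set.EqOn
      (fun s => ∫ r in (0:ℝ)..t, Real.exp (-θ * s) * Real.exp (-θ * r) *
        (1 / (2 * θ) * (Real.exp (2 * θ * min s r) - 1)))
      (fun s => 1 / (2 * θ ^ 2) * (2 - 2 * Real.exp (-θ * s) -
        Real.exp (-θ * t) * Real.exp (θ * s) + Real.exp (-θ * t) * Real.exp (-θ * s)))
      (Set.uIcc 0 t) := by
    intro s hs
    rw [Set.uIcc_of_le ht] at hs
    exact integral_ou_covariance t hθ hs.1 hs.2
  have hexp (c x : ℝ) :
      HasDerivAt (fun r => Real.exp (c * r)) (Real.exp (c * x) * c) x := by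
    simpa using ((hasDerivAt_id x).const_mul c).exp
  have hcont : Continuous fun s : ℝ => 1 / (2 * θ ^ 2) * (2 - 2 * Real.exp (-θ * s) -
      Real.exp (-θ * t) * Real.exp (θ * s) + Real.exp (-θ * t) * Real.exp (-θ * s)) := by
    fun_prop
  rw [intervalIntegral.integral_congr hinner,
    intervalIntegral.integral_eq_sub_of_hasDerivAt
      (f := fun s => 1 / (2 * θ ^ 3) * (2 * θ * s + 2 * Real.exp (-θ * s) -
        Real.exp (-θ * t) * Real.exp (θ * s) - Real.exp (-θ * t) * Real.exp (-θ * s)))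
      (fun s _ => ?_) (hcont.intervalIntegrable _ _)]
  · have hprod : Real.exp (-θ * t) * Real.exp (θ * t) = 1 := by
      rw [← Real.exp_add]; simp
    have hdouble : Real.exp (-2 * θ * t) = Real.exp (-θ * t) * Real.exp (-θ * t) := by
      rw [← Real.exp_add]; ring_nf
    rw [hdouble, hprod]
    simp only [mul_zero, Real.exp_zero]
    field_simp
    ring
  · refine ((((((hasDerivAt_id s).const_mul (2 * θ)).add ((hexp (-θ) s).const_mul 2)).sub
      ((hexp θ s).const_mul _)).sub ((hexp (-θ) s).const_mul _)).const_mul _).congr_deriv ?_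
    field_simp
    ring
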